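/- arXiv:2108.00398 — 2 statements merged into one kernel-verified Lean document; each statement's English description precedes it below -/
import Mathlib

section
/- Let n ≥ 4. Every local derivation of the (n−1)-ary algebra A_n is a derivation of A_n. -/
open Matrix in
/-- The derivative of the determinant of the rows along a linear map is its trace times the
determinant. -/
theorem sum_det_updateRow_linearMap {R ι : Type*} [CommRing R] [Fintype ι] [DecidableEq ι]
    (D : (ι → R) →ₗ[R] (ι → R)) (M : Matrix ι ι R) :
    ∑ j, (M.updateRow j (D (M j))).det = (LinearMap.toMatrix' D).trace * M.det := by
  have h (j : ι) : (M.updateRow j (D (M j))).det =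
      (Mᵀ.adjugate * (LinearMap.toMatrix' D * Mᵀ)) j j := by
    rw [← Matrix.cramer_transpose_apply, Matrix.cramer_eq_adjugate_mulVec,
      ← LinearMap.toMatrix'_mulVec D (M j)]
    rfl
  calc ∑ j, (M.updateRow j (D (M j))).det
      = (Mᵀ.adjugate * (LinearMap.toMatrix' D * Mᵀ)).trace := Finset.sum_congr rfl fun j _ => h j
    _ = (LinearMap.toMatrix' D).trace * M.det := by
      rw [Matrix.trace_mul_comm, Matrix.mul_assoc, Matrix.mul_adjugate]
      simp [mul_comm]

/-- An injection `Fin m → Fin (m + 1)` is a permutation followed by some `Fin.succAbove`. -/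
theorem exists_eq_succAbove_comp_perm {m : ℕ} {v : Fin m → Fin (m + 1)}
    (hv : Function.Injective v) :
    ∃ (i : Fin (m + 1)) (σ : Equiv.Perm (Fin m)), ∀ j, v j = i.succAbove (σ j) := by
  obtain ⟨i, hi⟩ : ∃ i, ∀ j, v j ≠ i := by
    by_contra! h
    simpa using Fintype.card_le_of_surjective v h
  choose f hf using fun j => Fin.exists_succAbove_eq (hi j)
  have hinj : Function.Injective f := fun a b hab => hv (by rw [← hf a, ← hf b, hab])
  exact ⟨i, Equiv.ofBijective f (Finite.injective_iff_bijective.mp hinj), fun j => (hf j).symm⟩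

/-- The `(n-1)`-ary bracket of `A_n` is the generalized cross product. -/
theorem bracket_apply_eq_det {m : ℕ}
    (bracket : AlternatingMap ℂ (Fin (m + 1) → ℂ) (Fin (m + 1) → ℂ) (Fin m))
    (hbr : ∀ i : Fin (m + 1),
      bracket (fun j => Pi.single (i.succAbove j) (1 : ℂ)) =
        ((-1 : ℂ) ^ ((m + 1) + ((i : ℕ) + 1))) • (Pi.single i (1 : ℂ) : Fin (m + 1) → ℂ))
    (x : Fin m → (Fin (m + 1) → ℂ)) (k : Fin (m + 1)) :
    bracket x k = (-1) ^ m * Matrix.detRowAlternating (Fin.cons (Pi.single k 1) x) := by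
  suffices h : (LinearMap.proj k).compAlternatingMap bracket =
      (-1 : ℂ) ^ m • (Matrix.detRowAlternating (R := ℂ) (n := Fin (m + 1))).curryLeft
        (Pi.single k 1) from congrArg (fun f => f x) h
  refine Module.Basis.ext_alternating (Pi.basisFun ℂ (Fin (m + 1))) fun v hv => ?_
  obtain ⟨i, σ, hσ⟩ := exists_eq_succAbove_comp_perm hv
  have hfun : (fun j => Pi.basisFun ℂ (Fin (m + 1)) (v j)) =
      (fun j => (Pi.single (i.succAbove j) (1 : ℂ) : Fin (m + 1) → ℂ)) ∘ σ := by
    funext j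
    simp [hσ]
  rw [hfun, AlternatingMap.map_perm, AlternatingMap.map_perm]
  congr 1
  change bracket (fun j => Pi.single (i.succAbove j) (1 : ℂ)) k =
    (-1) ^ m * Matrix.detRowAlternating
      (Fin.cons (Pi.single k 1) fun j => Pi.single (i.succAbove j) (1 : ℂ))
  rw [hbr]
  by_cases hki : k = i
  · subst hki
    change _ = _ * Matrix.det (Matrix.of
      (Fin.cons (Pi.single k 1) fun j => Pi.single (k.succAbove j) (1 : ℂ)))
    rw [Matrix.det_succ_row_zero, Finset.sum_eq_single k]
    · have hone : ((Matrix.of (Fin.cons (Pi.single k 1) fun j => Pi.single (k.succAbove j) (1 : ℂ)) :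
          Matrix (Fin (m + 1)) (Fin (m + 1)) ℂ).submatrix Fin.succ k.succAbove) = 1 := by
        ext a b
        simp [Matrix.one_apply, Pi.single_apply, eq_comm]
      rw [hone]
      simp
      ring
    · intro b _ hb
      simp [hb]
    · simp
  · obtain ⟨j, hj⟩ := Fin.exists_succAbove_eq hki
    rw [AlternatingMap.map_eq_zero_of_eq _ _ (i := 0) (j := j.succ) (by simp [hj])
      (Fin.succ_ne_zero j).symm]
    simp [hki]

/-- The bracket of `A_n` paired with a vector is a determinant. -/
theorem bracket_dotProduct_eq_det {m : ℕ}
    (bracket : AlternatingMap ℂ (Fin (m + 1) → ℂ) (Fin (m + 1) → ℂ) (Fin m))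
    (hbr : ∀ i : Fin (m + 1),
      bracket (fun j => Pi.single (i.succAbove j) (1 : ℂ)) =
        ((-1 : ℂ) ^ ((m + 1) + ((i : ℕ) + 1))) • (Pi.single i (1 : ℂ) : Fin (m + 1) → ℂ))
    (x : Fin m → (Fin (m + 1) → ℂ)) (y : Fin (m + 1) → ℂ) :
    bracket x ⬝ᵥ y = (-1) ^ m * Matrix.detRowAlternating (Fin.cons y x) := by
  have h := LinearMap.pi_apply_eq_sum_univ
    ((Matrix.detRowAlternating (R := ℂ) (n := Fin (m + 1))).toMultilinearMap.toLinearMap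
      (Fin.cons 0 x) 0) y
  simp only [MultilinearMap.toLinearMap_apply, AlternatingMap.coe_multilinearMap,
    Fin.update_cons_zero, smul_eq_mul] at h
  rw [h, Finset.mul_sum]
  refine Finset.sum_congr rfl fun k _ => ?_
  rw [bracket_apply_eq_det bracket hbr]
  have hk : (fun j => if k = j then (1 : ℂ) else 0) = Pi.single k 1 := by
    ext j
    simp [Pi.single_apply, eq_comm]
  rw [hk]
  ring

/-- The right-hand side of the derivation identity of `A_n`, paired with a vector. -/
theorem sum_bracket_update_dotProduct {m : ℕ}
    (bracket : AlternatingMap ℂ (Fin (m + 1) → ℂ) (Fin (m + 1) → ℂ) (Fin m))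
    (hbr : ∀ i : Fin (m + 1),
      bracket (fun j => Pi.single (i.succAbove j) (1 : ℂ)) =
        ((-1 : ℂ) ^ ((m + 1) + ((i : ℕ) + 1))) • (Pi.single i (1 : ℂ) : Fin (m + 1) → ℂ))
    (D : (Fin (m + 1) → ℂ) →ₗ[ℂ] (Fin (m + 1) → ℂ))
    (x : Fin m → (Fin (m + 1) → ℂ)) (y : Fin (m + 1) → ℂ) :
    (∑ j, bracket (Function.update x j (D (x j)))) ⬝ᵥ y =
      (LinearMap.toMatrix' D).trace * (bracket x ⬝ᵥ y) - bracket x ⬝ᵥ D y := by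
  have h := sum_det_updateRow_linearMap D (Fin.cons y x : Fin (m + 1) → Fin (m + 1) → ℂ)
  change ∑ j, Matrix.detRowAlternating (Function.update
      (Fin.cons y x : Fin (m + 1) → Fin (m + 1) → ℂ) j _) =
    _ * Matrix.detRowAlternating (Fin.cons y x : Fin (m + 1) → Fin (m + 1) → ℂ) at h
  rw [Fin.sum_univ_succ] at h
  simp only [Fin.cons_zero, Fin.cons_succ, Fin.update_cons_zero, ← Fin.cons_update] at h
  rw [sum_dotProduct]
  simp only [bracket_dotProduct_eq_det bracket hbr]
  rw [← Finset.mul_sum]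
  linear_combination (-1) ^ m * h

/-- Derivations of `A_n`, `n ≥ 3`, are skew-symmetric. -/
theorem dotProduct_derivation_self {m : ℕ} (hm : 2 ≤ m)
    (bracket : AlternatingMap ℂ (Fin (m + 1) → ℂ) (Fin (m + 1) → ℂ) (Fin m))
    (hbr : ∀ i : Fin (m + 1),
      bracket (fun j => Pi.single (i.succAbove j) (1 : ℂ)) =
        ((-1 : ℂ) ^ ((m + 1) + ((i : ℕ) + 1))) • (Pi.single i (1 : ℂ) : Fin (m + 1) → ℂ))
    (D : (Fin (m + 1) → ℂ) →ₗ[ℂ] (Fin (m + 1) → ℂ))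
    (hD : ∀ x : Fin m → (Fin (m + 1) → ℂ),
      D (bracket x) = ∑ j : Fin m, bracket (Function.update x j (D (x j))))
    (v : Fin (m + 1) → ℂ) : v ⬝ᵥ D v = 0 := by
  set t := (LinearMap.toMatrix' D).trace with ht
  have hbasis (i : Fin (m + 1)) (y : Fin (m + 1) → ℂ) :
      D (Pi.single i 1) ⬝ᵥ y = t * y i - D y i := by
    have h := sum_bracket_update_dotProduct bracket hbr D
      (fun j => Pi.single (i.succAbove j) (1 : ℂ)) y
    rw [← hD, hbr] at h
    simp only [map_smul, smul_dotProduct, smul_eq_mul, single_dotProduct, one_mul] at h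
    have hs : ((-1 : ℂ) ^ ((m + 1) + ((i : ℕ) + 1))) ≠ 0 := by simp
    apply mul_left_cancel₀ hs
    linear_combination h
  have htr : t = 0 := by
    have hdiag (i : Fin (m + 1)) : 2 * D (Pi.single i 1) i = t := by
      have h := hbasis i (Pi.single i 1)
      simp only [dotProduct_single, Pi.single_eq_same, mul_one] at h
      linear_combination h
    have hsum : t = ∑ i, D (Pi.single i 1) i := by
      simp [ht, Matrix.trace, LinearMap.toMatrix'_apply]
    have h2 : 2 * t = (m + 1) * t := by
      calc 2 * t = ∑ i : Fin (m + 1), t := by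
            rw [hsum, Finset.mul_sum, ← hsum]
            exact Finset.sum_congr rfl fun i _ => hdiag i
        _ = (m + 1) * t := by simp
    have hm1 : (m : ℂ) - 1 ≠ 0 := by
      rw [sub_ne_zero]
      exact_mod_cast (by omega : m ≠ 1)
    refine (mul_eq_zero.mp (?_ : ((m : ℂ) - 1) * t = 0)).resolve_left hm1
    linear_combination -h2
  have hskew : D v ⬝ᵥ v = - (v ⬝ᵥ D v) := by
    conv_lhs => rw [pi_eq_sum_univ' v, map_sum, sum_dotProduct, ← pi_eq_sum_univ' v]
    rw [dotProduct, ← Finset.sum_neg_distrib]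
    refine Finset.sum_congr rfl fun i _ => ?_
    rw [map_smul, smul_dotProduct, hbasis, htr, smul_eq_mul]
    ring
  rw [dotProduct_comm] at hskew
  exact self_eq_neg.mp hskew


/-- For `n = m + 1 ≥ 4`, every local derivation of the `(n-1)`-ary Filippov
algebra `A_n` is a derivation. -/
theorem local_derivation_is_derivation_An
    (m : ℕ) (hm : 3 ≤ m)
    (bracket : AlternatingMap ℂ (Fin (m + 1) → ℂ) (Fin (m + 1) → ℂ) (Fin m))
    (hbr : ∀ i : Fin (m + 1),
      bracket (fun j => Pi.single (i.succAbove j) (1 : ℂ)) =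
        ((-1 : ℂ) ^ ((m + 1) + ((i : ℕ) + 1))) • (Pi.single i (1 : ℂ) : Fin (m + 1) → ℂ))
    (nabla : (Fin (m + 1) → ℂ) →ₗ[ℂ] (Fin (m + 1) → ℂ))
    (hloc : ∀ v : Fin (m + 1) → ℂ, ∃ D : (Fin (m + 1) → ℂ) →ₗ[ℂ] (Fin (m + 1) → ℂ),
      (∀ x : Fin m → (Fin (m + 1) → ℂ),
        D (bracket x) = ∑ j : Fin m, bracket (Function.update x j (D (x j)))) ∧ nabla v = D v) :
    ∀ x : Fin m → (Fin (m + 1) → ℂ),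
      nabla (bracket x) = ∑ j : Fin m, bracket (Function.update x j (nabla (x j))) := by
  have hself (v : Fin (m + 1) → ℂ) : v ⬝ᵥ nabla v = 0 := by
    obtain ⟨D, hD, hv⟩ := hloc v
    rw [hv]
    exact dotProduct_derivation_self (by omega) bracket hbr D hD v
  have hskew (u v : Fin (m + 1) → ℂ) : nabla u ⬝ᵥ v = - (u ⬝ᵥ nabla v) := by
    have h := hself (u + v)
    rw [map_add, add_dotProduct, dotProduct_add, dotProduct_add, hself, hself,
      dotProduct_comm v] at h
    linear_combination h
  have htr : (LinearMap.toMatrix' nabla).trace = 0 := by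
    refine Finset.sum_eq_zero fun i _ => ?_
    have h := hself (Pi.single i 1)
    rw [single_dotProduct, one_mul] at h
    simpa [LinearMap.toMatrix'_apply, ← Pi.single_apply] using h
  intro x
  refine dotProduct_eq _ _ fun y => ?_
  rw [sum_bracket_update_dotProduct bracket hbr, htr, hskew]
  ring
end

section
/- Every derivation D of the ternary Malcev algebra M_8 is skew-adjoint with respect to the bilinear form: ⟨D(x), y⟩ + ⟨x, D(y)⟩ = 0 for all x, y ∈ O; equivalently, the matrix of D with respect to the orthonormal basis e_1,…,e_8 is antisymmetric. -/
noncomputable section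

/-- The complex octonions, realized by the Cayley–Dickson construction as
pairs of complex quaternions. -/
abbrev Oct : Type := Quaternion ℂ × Quaternion ℂ

namespace Oct

/-- Octonion multiplication: `(p,q)(r,s) = (pr − s̄q, sp + qr̄)`. -/
def mul (x y : Oct) : Oct :=
  (x.1 * y.1 - star y.2 * x.2, y.2 * x.1 + x.2 * star y.1)

/-- Octonion conjugation: `(p,q) ↦ (p̄, −q)`. -/
def conj (x : Oct) : Oct := (star x.1, -x.2)

/-- The octonion unit `1 = (1,0)`. -/
def one : Oct := (1, 0)

/-- The symmetric bilinear form `⟨·,·⟩` on the octonions, defined by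
`x ȳ + y x̄ = 2 ⟨x,y⟩ · 1` (the left-hand side always lies in `ℂ·1`). -/
def form (x y : Oct) : ℂ := ((mul x (conj y) + mul y (conj x)).1).re / 2

/-- The ternary Malcev product on `M₈`:
`[x,y,z] = (x ȳ) z − ⟨y,z⟩ x + ⟨x,z⟩ y − ⟨x,y⟩ z`. -/
def tmul (x y z : Oct) : Oct :=
  mul (mul x (conj y)) z - form y z • x + form x z • y - form x y • z

/-- A derivation of the ternary Malcev algebra `M₈`. -/
def IsDer (D : Oct →ₗ[ℂ] Oct) : Prop :=
  ∀ x y z : Oct, D (tmul x y z) = tmul (D x) y z + tmul x (D y) z + tmul x y (D z)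

/-- A local derivation of the ternary Malcev algebra `M₈`. -/
def IsLocDer (T : Oct →ₗ[ℂ] Oct) : Prop :=
  ∀ x : Oct, ∃ D : Oct →ₗ[ℂ] Oct, IsDer D ∧ T x = D x

end Oct

namespace Oct

lemma form_eq (x y : Oct) : form x y =
    x.1.re * y.1.re + x.1.imI * y.1.imI + x.1.imJ * y.1.imJ + x.1.imK * y.1.imK +
    (x.2.re * y.2.re + x.2.imI * y.2.imI + x.2.imJ * y.2.imJ + x.2.imK * y.2.imK) := by
  simp [form, mul, conj]
  ring

lemma form_comm (x y : Oct) : form x y = form y x := by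
  simp only [form_eq]
  ring

lemma form_add_left (x x' y : Oct) : form (x + x') y = form x y + form x' y := by
  simp only [form_eq, Prod.fst_add, Prod.snd_add, Quaternion.re_add, Quaternion.imI_add,
    Quaternion.imJ_add, Quaternion.imK_add]
  ring

lemma form_smul_left (c : ℂ) (x y : Oct) : form (c • x) y = c * form x y := by
  simp only [form_eq, Prod.smul_fst, Prod.smul_snd, Quaternion.re_smul, Quaternion.imI_smul,
    Quaternion.imJ_smul, Quaternion.imK_smul, smul_eq_mul]
  ring

lemma form_add_right (x y y' : Oct) : form x (y + y') = form x y + form x y' := by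
  rw [form_comm, form_add_left, form_comm y, form_comm y']

lemma form_smul_right (c : ℂ) (x y : Oct) : form x (c • y) = c * form x y := by
  rw [form_comm, form_smul_left, form_comm]

lemma mul_add_left (x x' y : Oct) : mul (x + x') y = mul x y + mul x' y := by
  ext <;> simp [mul] <;> ring

lemma mul_add_right (x y y' : Oct) : mul x (y + y') = mul x y + mul x y' := by
  ext <;> simp [mul] <;> ring

lemma conj_add (x y : Oct) : conj (x + y) = conj x + conj y := by
  ext <;> simp [conj] <;> ring

lemma tmul_add_left (x x' y z : Oct) : tmul (x + x') y z = tmul x y z + tmul x' y z := by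
  simp only [tmul, mul_add_left, form_add_left]
  module

lemma tmul_add_mid (x y y' z : Oct) : tmul x (y + y') z = tmul x y z + tmul x y' z := by
  simp only [tmul, mul_add_left, mul_add_right, conj_add, form_add_left, form_add_right]
  module

lemma tmul_add_right (x y z z' : Oct) : tmul x y (z + z') = tmul x y z + tmul x y z' := by
  simp only [tmul, mul_add_right, form_add_right]
  module

set_option maxHeartbeats 4000000 in
set_option maxRecDepth 10000 in
lemma tmul_tmul (x y z : Oct) : tmul x y (tmul x y z) =
    -(form x x * form y y - form x y ^ 2) • z +
      (form y y * form x z - form x y * form y z) • x +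
      (form x x * form y z - form x y * form x z) • y := by
  ext <;> simp [tmul, form_eq, mul, conj] <;> ring

lemma tmul_tmul_polar_left (u x y z : Oct) :
    tmul u y (tmul x y z) + tmul x y (tmul u y z) =
    -(2 * form u x * form y y - 2 * form x y * form u y) • z +
      (form y y * form u z - form u y * form y z) • x +
      (form y y * form x z - form x y * form y z) • u +
      (2 * form u x * form y z - form u y * form x z - form x y * form u z) • y := by
  have h := tmul_tmul (x + u) y z
  simp only [tmul_add_left, tmul_add_right, form_add_left, form_add_right] at h
  rw [form_comm x u] at h
  linear_combination (norm := module) h - tmul_tmul x y z - tmul_tmul u y z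

lemma tmul_tmul_polar_mid (v x y z : Oct) :
    tmul x v (tmul x y z) + tmul x y (tmul x v z) =
    -(2 * form v y * form x x - 2 * form x y * form x v) • z +
      (form x x * form v z - form x v * form x z) • y +
      (form x x * form y z - form x y * form x z) • v +
      (2 * form v y * form x z - form x v * form y z - form x y * form v z) • x := by
  have h := tmul_tmul x (y + v) z
  simp only [tmul_add_mid, tmul_add_right, form_add_left, form_add_right] at h
  rw [form_comm y v] at h
  linear_combination (norm := module) h - tmul_tmul x y z - tmul_tmul x v z

/-- If `x` and `y` are orthogonal and some unit vector is orthogonal to both, then a derivation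
infinitesimally preserves the Gram determinant of `x` and `y`. -/
lemma IsDer.form_add_form_eq_zero {D : Oct →ₗ[ℂ] Oct} (hD : IsDer D) {x y z : Oct}
    (hxy : form x y = 0) (hxz : form x z = 0) (hyz : form y z = 0) (hz : form z z = 1) :
    form (D x) x * form y y + form x x * form (D y) y = 0 := by
  have h := congrArg D (tmul_tmul x y z)
  rw [hD, hD] at h
  simp only [tmul_add_right, map_add, map_smul] at h
  rw [← add_assoc, add_add_add_comm, tmul_tmul_polar_left, tmul_tmul_polar_mid, tmul_tmul] at h
  have key := congrArg (fun w => form w z) h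
  simp only [form_add_left, form_smul_left,
    hxy, hxz, hyz, hz] at key
  linear_combination (-1 / 2) * key

/-- The distinguished basis of the octonions. -/
def e (i : Fin 8) : Oct :=
  (⟨if i = 0 then 1 else 0, if i = 1 then 1 else 0, if i = 2 then 1 else 0, if i = 3 then 1 else 0⟩,
   ⟨if i = 4 then 1 else 0, if i = 5 then 1 else 0, if i = 6 then 1 else 0, if i = 7 then 1 else 0⟩)

lemma form_e (i j : Fin 8) : form (e i) (e j) = if i = j then 1 else 0 := by
  fin_cases i <;> fin_cases j <;> simp [form_eq, e]

lemma sum_form_smul_e (x : Oct) : ∑ i, form x (e i) • e i = x := by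
  ext <;> simp [Fin.sum_univ_eight, form_eq] <;> simp [e]

lemma IsDer.form_self_e {D : Oct →ₗ[ℂ] Oct} (hD : IsDer D) (i : Fin 8) :
    form (D (e i)) (e i) = 0 := by
  obtain ⟨j, k, l, hij, hik, hil, hjk, hjl, hkl⟩ : ∃ j k l : Fin 8,
      i ≠ j ∧ i ≠ k ∧ i ≠ l ∧ j ≠ k ∧ j ≠ l ∧ k ≠ l := by
    revert i; decide
  have key (a b : Fin 8) (hab : a ≠ b) (hal : a ≠ l) (hbl : b ≠ l) :
      form (D (e a)) (e a) + form (D (e b)) (e b) = 0 := by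
    simpa [form_e] using hD.form_add_form_eq_zero (x := e a) (y := e b) (z := e l)
      (by simp [form_e, hab]) (by simp [form_e, hal]) (by simp [form_e, hbl]) (by simp [form_e])
  linear_combination (key i j hij hil hjl + key i k hik hil hkl - key j k hjk hjl hkl) / 2

lemma IsDer.form_e_add_form_e {D : Oct →ₗ[ℂ] Oct} (hD : IsDer D) (i j : Fin 8) :
    form (D (e i)) (e j) + form (e i) (D (e j)) = 0 := by
  rw [form_comm (e i)]
  obtain rfl | hij := eq_or_ne i j
  · simp [hD.form_self_e]
  obtain ⟨k, l, hik, hil, hjk, hjl, hkl⟩ : ∃ k l : Fin 8,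
      i ≠ k ∧ i ≠ l ∧ j ≠ k ∧ j ≠ l ∧ k ≠ l := by
    revert i j; decide
  have key := hD.form_add_form_eq_zero (x := e k) (y := e i + e j) (z := e l)
    (by simp [form_e, form_add_right, hik.symm, hjk.symm]) (by simp [form_e, hkl])
    (by simp [form_e, form_add_left, hil, hjl]) (by simp [form_e])
  simpa [form_e, form_add_left, form_add_right, hD.form_self_e, add_comm] using key

/-- The form as a bilinear map. -/
def formBilin : Oct →ₗ[ℂ] Oct →ₗ[ℂ] ℂ :=
  LinearMap.mk₂ ℂ form form_add_left form_smul_left form_add_right form_smul_right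

end Oct

open Oct in
/-- Every derivation of the ternary Malcev algebra `M₈` is skew-adjoint with
respect to the bilinear form `⟨·,·⟩`. -/
theorem derivation_skew_adjoint (D : Oct →ₗ[ℂ] Oct) (hD : IsDer D) :
    ∀ x y : Oct, form (D x) y + form x (D y) = 0 := by
  intro x y
  change formBilin (D x) y + formBilin x (D y) = 0
  rw [← sum_form_smul_e x, ← sum_form_smul_e y]
  simp only [map_sum, map_smul, LinearMap.sum_apply, LinearMap.smul_apply,
    ← Finset.sum_add_distrib, ← smul_add]
  refine Finset.sum_eq_zero fun i _ => ?_
  rw [Finset.sum_eq_zero, smul_zero]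
  intro j _
  simp [formBilin, hD.form_e_add_form_e]
end
end
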